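/- arXiv:1109.0751 — 3 statements merged into one kernel-verified Lean document; each statement's English description precedes it below -/
import Mathlib

section
/- Let f₁, g₁ : ℝ^m → ℝ^n be C^∞ maps having the same k-jet at x (so in particular f₁(x) = g₁(x) = y), and let f₂, g₂ : ℝ^n → ℝ^p be C^∞ maps having the same k-jet at y. Then the compositions f₂ ∘ f₁ and g₂ ∘ g₁ have the same k-jet at x: iteratedFDeriv ℝ j (f₂ ∘ f₁) x = iteratedFDeriv ℝ j (g₂ ∘ g₁) x for all j ≤ k. (Hence the composition of k-jets, j^k_{f₁(x)}(f₂) ∘ j^k_x(f₁) = j^k_x(f₂ ∘ f₁), is well defined.) -/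
/-- Composition of `k`-jets is well defined: if `f₁, g₁` have the same `k`-jet at `x`
(with common value `y`) and `f₂, g₂` have the same `k`-jet at `y`, then `f₂ ∘ f₁` and
`g₂ ∘ g₁` have the same `k`-jet at `x`. -/
theorem kjet_comp_well_defined {m n p : ℕ} (k : ℕ)
    (f₁ g₁ : (Fin m → ℝ) → (Fin n → ℝ)) (f₂ g₂ : (Fin n → ℝ) → (Fin p → ℝ))
    (x : Fin m → ℝ) (y : Fin n → ℝ)
    (hf₁ : ContDiff ℝ (⊤ : ℕ∞) f₁) (hg₁ : ContDiff ℝ (⊤ : ℕ∞) g₁)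
    (hf₂ : ContDiff ℝ (⊤ : ℕ∞) f₂) (hg₂ : ContDiff ℝ (⊤ : ℕ∞) g₂)
    (hf₁x : f₁ x = y) (hg₁x : g₁ x = y)
    (hjet₁ : ∀ j ≤ k, iteratedFDeriv ℝ j f₁ x = iteratedFDeriv ℝ j g₁ x)
    (hval₂ : f₂ y = g₂ y)
    (hjet₂ : ∀ j ≤ k, iteratedFDeriv ℝ j f₂ y = iteratedFDeriv ℝ j g₂ y) :
    ∀ j ≤ k, iteratedFDeriv ℝ j (f₂ ∘ f₁) x = iteratedFDeriv ℝ j (g₂ ∘ g₁) x := by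
  intro j hj
  have hle : ((j : ℕ) : WithTop ℕ∞) ≤ ((⊤ : ℕ∞) : WithTop ℕ∞) := by
    exact_mod_cast (le_top : (j : ℕ∞) ≤ ⊤)
  rw [iteratedFDeriv_comp hf₂.contDiffAt hf₁.contDiffAt hle,
    iteratedFDeriv_comp hg₂.contDiffAt hg₁.contDiffAt hle, hf₁x, hg₁x]
  simp only [FormalMultilinearSeries.taylorComp,
    FormalMultilinearSeries.compAlongOrderedFinpartition, ftaylorSeries]
  refine Finset.sum_congr rfl fun c _ => ?_
  rw [hjet₂ _ (c.length_le.trans hj)]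
  congr 1
  funext i
  exact hjet₁ _ ((c.partSize_le i).trans hj)
end

section
/- The change from natural to algebraic coordinates is a group isomorphism: the map sending (P, S) ∈ D^{(2)}(m) to (P, a) ∈ GL^{(1)}(m), where a ∈ L(ℝ^m, M_m(ℝ)) is determined by a(v)·w = P⁻¹·S(v, w), is a bijective group homomorphism from (D^{(2)}(m), •) with product (P₁, S₁) • (P₂, S₂) = (P₁·P₂, (u, v) ↦ S₁(P₂·u, P₂·v) + P₁·S₂(u, v)) onto GL^{(1)}(m) with product (g, a) * (h, b) = (g·h, v ↦ h⁻¹ · a(h·v) · h + b(v)). -/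
/-- Pairs `(P, S)` with `P ∈ GL(m, ℝ)` and `S` bilinear: the nonholonomic second-order
differential group `D^{(2)}(m)` in natural coordinates. -/
abbrev D2Set (m : ℕ) :=
  GL (Fin m) ℝ × ((Fin m → ℝ) →ₗ[ℝ] (Fin m → ℝ) →ₗ[ℝ] (Fin m → ℝ))

/-- The chain-rule product on `D^{(2)}(m)`:
`(P₁, S₁) • (P₂, S₂) = (P₁·P₂, (u, v) ↦ S₁(P₂·u, P₂·v) + P₁·S₂(u, v))`. -/
noncomputable def d2Mul {m : ℕ} (p q : D2Set m) : D2Set m :=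
  (p.1 * q.1,
    p.2.compl₁₂ (Matrix.mulVecLin (↑q.1 : Matrix (Fin m) (Fin m) ℝ))
        (Matrix.mulVecLin (↑q.1 : Matrix (Fin m) (Fin m) ℝ))
      + q.2.compr₂ (Matrix.mulVecLin (↑p.1 : Matrix (Fin m) (Fin m) ℝ)))

/-- Pairs `(g, a)` with `g ∈ GL(m, ℝ)` and `a : ℝ^m → M_m(ℝ)` linear:
the group `GL^{(1)}(m)` in algebraic coordinates. -/
abbrev GLProlong (m : ℕ) :=
  GL (Fin m) ℝ × ((Fin m → ℝ) →ₗ[ℝ] Matrix (Fin m) (Fin m) ℝ)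

/-- The product `(g, a) * (h, b) = (g·h, v ↦ h⁻¹ · a(h·v) · h + b(v))` on `GL^{(1)}(m)`. -/
def glProlongMul {m : ℕ} (p q : GLProlong m) : GLProlong m :=
  (p.1 * q.1,
    (LinearMap.mulRight ℝ (↑q.1 : Matrix (Fin m) (Fin m) ℝ)).comp
      ((LinearMap.mulLeft ℝ (↑(q.1⁻¹) : Matrix (Fin m) (Fin m) ℝ)).comp
        (p.2.comp (Matrix.mulVecLin (↑q.1 : Matrix (Fin m) (Fin m) ℝ)))) + q.2)

/-- The change from natural to algebraic coordinates:
`Φ(P, S) = (P, a)` where `a(v)·w = P⁻¹·S(v, w)`. -/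
noncomputable def d2ToGLProlong {m : ℕ} (p : D2Set m) : GLProlong m :=
  (p.1,
    (LinearMap.toMatrix' :
        ((Fin m → ℝ) →ₗ[ℝ] (Fin m → ℝ)) ≃ₗ[ℝ] Matrix (Fin m) (Fin m) ℝ).toLinearMap.comp
      ((LinearMap.llcomp ℝ (Fin m → ℝ) (Fin m → ℝ) (Fin m → ℝ)
          (Matrix.mulVecLin (↑(p.1⁻¹) : Matrix (Fin m) (Fin m) ℝ))).comp p.2))

/-- The change from natural to algebraic coordinates, `(P, S) ↦ (P, a)` with
`a(v)·w = P⁻¹·S(v, w)`, is a bijective group homomorphism from `D^{(2)}(m)`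
(chain-rule product) onto `GL^{(1)}(m)` (product
`(g, a) * (h, b) = (g·h, v ↦ h⁻¹ · a(h·v) · h + b(v))`). -/
theorem d2ToGLProlong_is_group_isomorphism (m : ℕ) :
    (∀ p : D2Set m, (d2ToGLProlong p).1 = p.1 ∧ ∀ v w,
        ((d2ToGLProlong p).2 v).mulVec w =
          (↑(p.1⁻¹) : Matrix (Fin m) (Fin m) ℝ).mulVec (p.2 v w)) ∧
    Function.Bijective (d2ToGLProlong (m := m)) ∧
    (∀ p q : D2Set m,
        d2ToGLProlong (d2Mul p q) = glProlongMul (d2ToGLProlong p) (d2ToGLProlong q)) := by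
  have key : ∀ p : D2Set m, ∀ v w, ((d2ToGLProlong p).2 v).mulVec w =
      (↑(p.1⁻¹) : Matrix (Fin m) (Fin m) ℝ).mulVec (p.2 v w) := by
    intro p v w
    simp only [d2ToGLProlong, LinearMap.comp_apply, LinearEquiv.coe_coe,
      LinearMap.toMatrix'_mulVec, LinearMap.llcomp_apply, Matrix.mulVecLin_apply]
  have e1 : ∀ g : GL (Fin m) ℝ, (↑g : Matrix (Fin m) (Fin m) ℝ) *
      (↑(g⁻¹) : Matrix (Fin m) (Fin m) ℝ) = 1 := fun g => Units.mul_inv g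
  have e2 : ∀ g : GL (Fin m) ℝ, (↑(g⁻¹) : Matrix (Fin m) (Fin m) ℝ) *
      (↑g : Matrix (Fin m) (Fin m) ℝ) = 1 := fun g => Units.inv_mul g
  have hext : ∀ x y : GLProlong m, x.1 = y.1 →
      (∀ v w, (x.2 v).mulVec w = (y.2 v).mulVec w) → x = y := by
    intro x y h1 h2
    refine Prod.ext h1 (LinearMap.ext fun v => ?_)
    exact Matrix.mulVec_injective (funext fun w => h2 v w)
  refine ⟨fun p => ⟨rfl, key p⟩, ⟨?_, ?_⟩, ?_⟩
  · intro p q h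
    have h1 : p.1 = q.1 := congrArg (fun z : GLProlong m => z.1) h
    refine Prod.ext h1 (LinearMap.ext fun v => LinearMap.ext fun w => ?_)
    have h2 := key p v w
    rw [h, key q v w, ← h1] at h2
    have h3 := congrArg (fun z => (↑p.1 : Matrix (Fin m) (Fin m) ℝ).mulVec z) h2
    simp only [Matrix.mulVec_mulVec, e1, Matrix.one_mulVec] at h3
    exact h3.symm
  · intro x
    refine ⟨(x.1, LinearMap.compr₂ ((Matrix.toLin' :
      Matrix (Fin m) (Fin m) ℝ ≃ₗ[ℝ] _).toLinearMap.comp x.2)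
      (Matrix.mulVecLin (↑x.1 : Matrix (Fin m) (Fin m) ℝ))), hext _ _ rfl fun v w => ?_⟩
    rw [key]
    simp only [LinearMap.compr₂_apply, LinearMap.comp_apply, LinearEquiv.coe_coe,
      Matrix.toLin'_apply, Matrix.mulVecLin_apply]
    rw [Matrix.mulVec_mulVec, e2, Matrix.one_mulVec]
  · intro p q
    refine hext _ _ rfl fun v w => ?_
    rw [key]
    have hr : ((glProlongMul (d2ToGLProlong p) (d2ToGLProlong q)).2 v) =
      (↑(q.1⁻¹) : Matrix (Fin m) (Fin m) ℝ) * ((d2ToGLProlong p).2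
        ((↑q.1 : Matrix (Fin m) (Fin m) ℝ).mulVec v)) * (↑q.1 : Matrix (Fin m) (Fin m) ℝ)
        + (d2ToGLProlong q).2 v := rfl
    have hl : (d2Mul p q).2 v w = p.2 ((↑q.1 : Matrix (Fin m) (Fin m) ℝ).mulVec v)
        ((↑q.1 : Matrix (Fin m) (Fin m) ℝ).mulVec w)
        + (↑p.1 : Matrix (Fin m) (Fin m) ℝ).mulVec (q.2 v w) := rfl
    have hi : (↑((d2Mul p q).1⁻¹) : Matrix (Fin m) (Fin m) ℝ) =
        (↑(q.1⁻¹) : Matrix (Fin m) (Fin m) ℝ) * (↑(p.1⁻¹) : Matrix (Fin m) (Fin m) ℝ) := by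
      change (↑((p.1 * q.1)⁻¹) : Matrix (Fin m) (Fin m) ℝ) = _
      rw [mul_inv_rev, Units.val_mul]
    rw [hr, hl, hi, Matrix.add_mulVec, key, ← Matrix.mulVec_mulVec, ← Matrix.mulVec_mulVec,
      ← Matrix.mulVec_mulVec, key, Matrix.mulVec_add, Matrix.mulVec_add]
    congr 2
    rw [Matrix.mulVec_mulVec, e2, Matrix.one_mulVec]
end

section
/- Inversion of 2-jets is well defined: let f, g : ℝ^m → ℝ^m be C^∞ maps with f(x) = g(x) = y, with Df(x) invertible, and let f⁻¹ and g⁻¹ be local C^∞ inverses of f and g near y (so f⁻¹(y) = g⁻¹(y) = x, f⁻¹ ∘ f = id and g⁻¹ ∘ g = id near x). If iteratedFDeriv ℝ j f x = iteratedFDeriv ℝ j g x for all j ≤ 2, then iteratedFDeriv ℝ j f⁻¹ y = iteratedFDeriv ℝ j g⁻¹ y for all j ≤ 2. -/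
theorem jet_aux {E : Type*} [NormedAddCommGroup E] [NormedSpace ℝ E]
    (F F' : E → E) (x : E) (hF : ContDiff ℝ (⊤ : ℕ∞) F) (hF' : ContDiff ℝ (⊤ : ℕ∞) F')
    (h : ∀ᶠ z in nhds x, F' (F z) = z) :
    (∀ v, fderiv ℝ F' (F x) (fderiv ℝ F x v) = v) ∧
    ∀ u v, fderiv ℝ (fderiv ℝ F') (F x) (fderiv ℝ F x u) (fderiv ℝ F x v)
      + fderiv ℝ F' (F x) (fderiv ℝ (fderiv ℝ F) x u v) = 0 := by
  have dF : Differentiable ℝ F := hF.differentiable (by simp)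
  have dF' : Differentiable ℝ F' := hF'.differentiable (by simp)
  have ddF : Differentiable ℝ (fderiv ℝ F) :=
    (hF.fderiv_right (m := 1) (by norm_cast)).differentiable (by simp)
  have ddF' : Differentiable ℝ (fderiv ℝ F') :=
    (hF'.fderiv_right (m := 1) (by norm_cast)).differentiable (by simp)
  have key : ∀ᶠ z in nhds x, ∀ v, fderiv ℝ F' (F z) (fderiv ℝ F z v) = v := by
    filter_upwards [h.eventually_nhds] with z hz v
    have h1 : HasFDerivAt (fun z => F' (F z)) ((fderiv ℝ F' (F z)).comp (fderiv ℝ F z)) z :=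
      (dF' (F z)).hasFDerivAt.comp z (dF z).hasFDerivAt
    have h2 : HasFDerivAt (fun z => F' (F z)) (ContinuousLinearMap.id ℝ E) z :=
      (hasFDerivAt_id z).congr_of_eventuallyEq hz
    have := h1.unique h2
    simpa using congrArg (fun L => L v) this
  refine ⟨key.self_of_nhds, fun u v => ?_⟩
  have h1 : HasFDerivAt (fun z => fderiv ℝ F' (F z))
      ((fderiv ℝ (fderiv ℝ F') (F x)).comp (fderiv ℝ F x)) x :=
    (ddF' (F x)).hasFDerivAt.comp x (dF x).hasFDerivAt
  have h2 := h1.clm_apply ((ddF x).hasFDerivAt.clm_apply (hasFDerivAt_const v x))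
  have h3 : HasFDerivAt (fun z => fderiv ℝ F' (F z) (fderiv ℝ F z v)) (0 : E →L[ℝ] E) x :=
    (hasFDerivAt_const v x).congr_of_eventuallyEq (key.mono fun z hz => hz v)
  have := congrArg (fun L => L u) (h2.unique h3)
  simp at this
  rw [← this, add_comm]

/-- Inversion of 2-jets is well defined: if C^∞ maps `f, g` have the same 2-jet at `x`
(common value `y`, invertible differential) and `f'`, `g'` are local C^∞ inverses of
`f` and `g` near `y`, then `f'` and `g'` have the same 2-jet at `y`. -/
theorem two_jet_inversion_well_defined {m : ℕ}
    (f g f' g' : (Fin m → ℝ) → (Fin m → ℝ)) (x y : Fin m → ℝ)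
    (hf : ContDiff ℝ (⊤ : ℕ∞) f) (hg : ContDiff ℝ (⊤ : ℕ∞) g)
    (hfx : f x = y) (hgx : g x = y)
    (A : (Fin m → ℝ) ≃L[ℝ] (Fin m → ℝ))
    (hA : (A : (Fin m → ℝ) →L[ℝ] (Fin m → ℝ)) = fderiv ℝ f x)
    (hf' : ContDiff ℝ (⊤ : ℕ∞) f') (hg' : ContDiff ℝ (⊤ : ℕ∞) g')
    (hf'y : f' y = x) (hg'y : g' y = x)
    (hf'inv : ∀ᶠ z in nhds x, f' (f z) = z)
    (hg'inv : ∀ᶠ z in nhds x, g' (g z) = z)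
    (hjet : ∀ j ≤ 2, iteratedFDeriv ℝ j f x = iteratedFDeriv ℝ j g x) :
    ∀ j ≤ 2, iteratedFDeriv ℝ j f' y = iteratedFDeriv ℝ j g' y := by
  obtain ⟨a1, a2⟩ := jet_aux f f' x hf hf' hf'inv
  obtain ⟨b1, b2⟩ := jet_aux g g' x hg hg' hg'inv
  have e1 : fderiv ℝ f x = fderiv ℝ g x := by
    ext1 v
    have := congrArg (fun L => L ![v]) (hjet 1 (by norm_num))
    simpa [iteratedFDeriv_one_apply] using this
  have e2 : ∀ u v, fderiv ℝ (fderiv ℝ f) x u v = fderiv ℝ (fderiv ℝ g) x u v := by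
    intro u v
    have := congrArg (fun L => L ![u, v]) (hjet 2 le_rfl)
    simpa [iteratedFDeriv_two_apply] using this
  rw [hfx] at a1 a2
  rw [hgx] at b1 b2
  have sur : ∀ w, ∃ v, fderiv ℝ g x v = w := fun w => ⟨A.symm w, by rw [← e1, ← hA]; simp⟩
  rw [e1] at a1 a2
  have d1 : fderiv ℝ f' y = fderiv ℝ g' y := by
    ext1 w
    obtain ⟨v, rfl⟩ := sur w
    rw [a1, b1]
  have d2 : fderiv ℝ (fderiv ℝ f') y = fderiv ℝ (fderiv ℝ g') y := by
    ext1 w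
    ext1 w'
    obtain ⟨u, rfl⟩ := sur w
    obtain ⟨v, rfl⟩ := sur w'
    have h1 := a2 u v
    rw [e2, d1, ← b2 u v] at h1
    exact add_right_cancel h1
  intro j hj
  interval_cases j
  · ext1 v
    simp [hf'y, hg'y]
  · ext1 v
    simp [iteratedFDeriv_one_apply, d1]
  · ext1 v
    simp [iteratedFDeriv_two_apply, d2]
end
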